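/- arXiv:1510.04265 — 2 statements merged into one kernel-verified Lean document; each statement's English description precedes it below -/
import Mathlib

section
/- Let K be a field and let (C, d, F) be a filtered complex. For every x in ker d̂, and every t ∈ ℝ, the image π_t(x) ∈ C ⧸ F t is a d_t-cycle, and its cohomology classes form a compatible family, giving a K-linear map Φ from ker d̂ to the inverse limit lim←_{t} H_t(C) (over the maps H_s(C) → H_t(C) for s ≤ t). Then Φ vanishes on ⋂_{t∈ℝ} (range d̂ + ker π_t), and the induced K-linear map from the reduced cohomology H̄(C) = ker d̂ ⧸ ⋂_{t∈ℝ} (range d̂ + ker π_t) to lim←_{t} H_t(C) is an isomorphism. -/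
/-!
Statement 0: for a filtered complex `(C, d, F)` over a field `K`, the map `Φ` sending a
`d̂`-cycle of the completion `Ĉ` to the compatible family of its cohomology classes in the
truncated cohomologies `H_t(C)` vanishes on `⋂ t, (range d̂ + ker π_t)`, and the induced
map from the reduced cohomology `H̄(C) = ker d̂ ⧸ ⋂ t, (range d̂ + ker π_t)` onto the
inverse limit `lim←_t H_t(C)` is an isomorphism.

The completion `Ĉ` is realized as the submodule `Chat` of compatible families of the
product `∏ t, C ⧸ F t`; the differential `d̂` acts on it as (the restriction of) the
componentwise differential `Dpi`, and `π_t` is (the restriction of) the projection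
`LinearMap.proj t`.  Accordingly `ker d̂ = Chat ⊓ ker Dpi`,
`range d̂ = Submodule.map Dpi Chat` and `ker π_t = Chat ⊓ ker (LinearMap.proj t)` as
submodules of the product.
-/

section FilteredComplex

variable {K : Type*} [Field K]
variable {C : Type*} [AddCommGroup C] [Module K C]

/-- The homology of a differential module `(A, dA)`: `ker dA ⧸ range dA`. -/
abbrev homologyOf {A : Type*} [AddCommGroup A] [Module K A] (dA : A →ₗ[K] A) :=
  LinearMap.ker dA ⧸ (LinearMap.range dA).comap (LinearMap.ker dA).subtype

/-- A chain map restricts to a map of cycles. -/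
def cyclesMap {A B : Type*} [AddCommGroup A] [Module K A] [AddCommGroup B] [Module K B]
    (dA : A →ₗ[K] A) (dB : B →ₗ[K] B) (g : A →ₗ[K] B)
    (hg : g ∘ₗ dA = dB ∘ₗ g) :
    LinearMap.ker dA →ₗ[K] LinearMap.ker dB :=
  g.restrict (p := LinearMap.ker dA) (q := LinearMap.ker dB) (fun x hx => by
    have hgx := LinearMap.congr_fun hg x
    simp only [LinearMap.comp_apply] at hgx
    simp only [LinearMap.mem_ker] at hx ⊢
    rw [← hgx, hx, map_zero])

/-- The map induced on homology by a chain map. -/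
def inducedHom {A B : Type*} [AddCommGroup A] [Module K A] [AddCommGroup B] [Module K B]
    (dA : A →ₗ[K] A) (dB : B →ₗ[K] B) (g : A →ₗ[K] B)
    (hg : g ∘ₗ dA = dB ∘ₗ g) :
    homologyOf dA →ₗ[K] homologyOf dB :=
  Submodule.mapQ _ _ (cyclesMap dA dB g hg) (by
    rintro ⟨x, hx⟩ hmem
    rw [Submodule.mem_comap] at hmem ⊢
    obtain ⟨y, hy⟩ := hmem
    refine ⟨g y, ?_⟩
    have hgy := LinearMap.congr_fun hg y
    simp only [LinearMap.comp_apply] at hgy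
    have hcoe : ((cyclesMap dA dB g hg ⟨x, hx⟩ : LinearMap.ker dB) : B) = g x :=
      LinearMap.restrict_coe_apply _ _ _
    show dB (g y) = _
    rw [← hgy]
    simp only [Submodule.coe_subtype]
    rw [hcoe]
    exact congrArg g hy)

variable (d : C →ₗ[K] C) (F : ℝ → Submodule K C)
variable (hmono : Monotone F) (hdF : ∀ t, (F t).map d ≤ F t)

/-- The differential induced on the quotient `C ⧸ F t`. -/
def dQ (t : ℝ) : (C ⧸ F t) →ₗ[K] (C ⧸ F t) :=
  Submodule.mapQ (F t) (F t) d (Submodule.map_le_iff_le_comap.mp (hdF t))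

/-- The projection `C ⧸ F s → C ⧸ F t` for `s ≤ t`. -/
def projQ {s t : ℝ} (h : s ≤ t) : (C ⧸ F s) →ₗ[K] (C ⧸ F t) :=
  Submodule.mapQ (F s) (F t) LinearMap.id (fun _ hx => hmono h hx)

/-- The projections are chain maps. -/
lemma projQ_dQ {s t : ℝ} (h : s ≤ t) :
    (projQ F hmono h) ∘ₗ (dQ d F hdF s) = (dQ d F hdF t) ∘ₗ (projQ F hmono h) := by
  apply Submodule.linearMap_qext
  rfl

/-- The completion `Ĉ`: compatible families in `∏ t, C ⧸ F t`. -/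
def Chat : Submodule K (∀ t : ℝ, C ⧸ F t) where
  carrier := {x | ∀ ⦃s t : ℝ⦄ (h : s ≤ t), projQ F hmono h (x s) = x t}
  add_mem' := by
    intro a b ha hb s t h
    simp only [Pi.add_apply, map_add, ha h, hb h]
  zero_mem' := by
    intro s t h
    simp only [Pi.zero_apply, map_zero]
  smul_mem' := by
    intro c a ha s t h
    simp only [Pi.smul_apply, map_smul, ha h]

/-- The componentwise differential on `∏ t, C ⧸ F t`; the differential `d̂` of the
completion is its restriction to `Chat`. -/
def Dpi : (∀ t : ℝ, C ⧸ F t) →ₗ[K] (∀ t : ℝ, C ⧸ F t) :=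
  LinearMap.pi (fun t => (dQ d F hdF t).comp (LinearMap.proj t))

/-- The kernel of `d̂ : Ĉ → Ĉ`, as a submodule of the product. -/
def Zhat : Submodule K (∀ t : ℝ, C ⧸ F t) :=
  Chat F hmono ⊓ LinearMap.ker (Dpi d F hdF)

/-- For a `d̂`-cycle `x` of the completion, each component `π_t x` is a `d_t`-cycle. -/
def PhiComp (t : ℝ) :
    (Zhat d F hmono hdF : Submodule K (∀ t : ℝ, C ⧸ F t)) →ₗ[K]
      LinearMap.ker (dQ d F hdF t) :=
  LinearMap.codRestrict (LinearMap.ker (dQ d F hdF t))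
    ((LinearMap.proj t).comp (Zhat d F hmono hdF).subtype)
    (fun x => by
      have hx : Dpi d F hdF x.1 = 0 := x.2.2
      have h2 := congrFun hx t
      simpa [Dpi, LinearMap.mem_ker] using h2)

/-- The family of cohomology classes of the components of a `d̂`-cycle. -/
def PhiPi :
    (Zhat d F hmono hdF : Submodule K (∀ t : ℝ, C ⧸ F t)) →ₗ[K]
      (∀ t : ℝ, homologyOf (dQ d F hdF t)) :=
  LinearMap.pi (fun t =>
    (((LinearMap.range (dQ d F hdF t)).comap
        (LinearMap.ker (dQ d F hdF t)).subtype).mkQ).comp (PhiComp d F hmono hdF t))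

/-- The inverse limit `lim←_t H_t(C)` of the truncated cohomologies, realized as the
submodule of compatible families in `∏ t, H_t(C)` (compatibility being with respect to
the maps `H_s(C) → H_t(C)` induced by the projections, for `s ≤ t`). -/
def Hlim : Submodule K (∀ t : ℝ, homologyOf (dQ d F hdF t)) where
  carrier := {x | ∀ ⦃s t : ℝ⦄ (h : s ≤ t),
    inducedHom (dQ d F hdF s) (dQ d F hdF t) (projQ F hmono h)
      (projQ_dQ d F hmono hdF h) (x s) = x t}
  add_mem' := by
    intro a b ha hb s t h
    simp only [Pi.add_apply, map_add, ha h, hb h]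
  zero_mem' := by
    intro s t h
    simp only [Pi.zero_apply, map_zero]
  smul_mem' := by
    intro c a ha s t h
    simp only [Pi.smul_apply, map_smul, ha h]

lemma PhiPi_mem_Hlim (x : (Zhat d F hmono hdF : Submodule K (∀ t : ℝ, C ⧸ F t))) :
    PhiPi d F hmono hdF x ∈ Hlim d F hmono hdF := by
  intro s t h
  show inducedHom (dQ d F hdF s) (dQ d F hdF t) (projQ F hmono h)
      (projQ_dQ d F hmono hdF h)
      (Submodule.Quotient.mk (PhiComp d F hmono hdF s x)) =
    Submodule.Quotient.mk (PhiComp d F hmono hdF t x)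
  rw [inducedHom, Submodule.mapQ_apply]
  congr 1
  apply Subtype.ext
  show projQ F hmono h (x.1 s) = x.1 t
  exact x.2.1 h

/-- The map `Φ` sending a `d̂`-cycle of the completion to the compatible family of the
cohomology classes of its components, with values in the inverse limit `lim←_t H_t(C)`. -/
def Phi :
    (Zhat d F hmono hdF : Submodule K (∀ t : ℝ, C ⧸ F t)) →ₗ[K]
      (Hlim d F hmono hdF : Submodule K (∀ t : ℝ, homologyOf (dQ d F hdF t))) :=
  LinearMap.codRestrict (Hlim d F hmono hdF) (PhiPi d F hmono hdF)
    (PhiPi_mem_Hlim d F hmono hdF)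

/-- The closure of the range of `d̂` in the linear topology of the completion:
`⋂ t, (range d̂ + ker π_t)`, pulled back to the `d̂`-cycles. -/
def Nred : Submodule K (Zhat d F hmono hdF : Submodule K (∀ t : ℝ, C ⧸ F t)) :=
  (⨅ t : ℝ, (Submodule.map (Dpi d F hdF) (Chat F hmono) ⊔
      (Chat F hmono ⊓ LinearMap.ker (LinearMap.proj (R := K)
        (φ := fun t : ℝ => C ⧸ F t) t)))).comap
    (Zhat d F hmono hdF).subtype

/-- The element `c` is a cycle modulo `F t` whose class in the truncated cohomology is `a`. -/
def Represents (t : ℝ) (c : C) (a : homologyOf (dQ d F hdF t)) : Prop :=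
  ∃ z : LinearMap.ker (dQ d F hdF t),
    (z : C ⧸ F t) = Submodule.Quotient.mk c ∧ Submodule.Quotient.mk z = a

lemma exists_represents (t : ℝ) (a : homologyOf (dQ d F hdF t)) :
    ∃ c, Represents d F hdF t c a := by
  obtain ⟨z, rfl⟩ := Submodule.Quotient.mk_surjective _ a
  obtain ⟨c, hc⟩ := Submodule.Quotient.mk_surjective _ (z : C ⧸ F t)
  exact ⟨c, z, hc.symm, rfl⟩

variable {d F hdF} in
lemma Represents.mono {s t : ℝ} (h : s ≤ t) {c : C} {a : homologyOf (dQ d F hdF s)}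
    (hc : Represents d F hdF s c a) :
    Represents d F hdF t c (inducedHom (dQ d F hdF s) (dQ d F hdF t) (projQ F hmono h)
      (projQ_dQ d F hmono hdF h) a) := by
  obtain ⟨z, hz, rfl⟩ := hc
  refine ⟨cyclesMap (dQ d F hdF s) (dQ d F hdF t) (projQ F hmono h)
    (projQ_dQ d F hmono hdF h) z, ?_, rfl⟩
  show projQ F hmono h z = _
  rw [hz]
  rfl

variable {d F hdF} in
lemma Represents.exists_sub_sub_mem {t : ℝ} {c c' : C} {a : homologyOf (dQ d F hdF t)}
    (hc : Represents d F hdF t c a) (hc' : Represents d F hdF t c' a) :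
    ∃ b, c' - d b - c ∈ F t := by
  obtain ⟨z, hz, rfl⟩ := hc
  obtain ⟨z', hz', h⟩ := hc'
  obtain ⟨y, hy⟩ := (Submodule.Quotient.eq _).mp h
  obtain ⟨b, rfl⟩ := Submodule.Quotient.mk_surjective _ y
  refine ⟨b, ?_⟩
  have hy' : (Submodule.Quotient.mk (d b) : C ⧸ F t) = z' - z := hy
  rw [← Submodule.Quotient.mk_eq_zero (F t), Submodule.Quotient.mk_sub,
    Submodule.Quotient.mk_sub, hy', hz, hz']
  abel

variable {d F hdF} in
lemma Represents.sub_boundary (hdd : d ∘ₗ d = 0) {t : ℝ} {c : C}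
    {a : homologyOf (dQ d F hdF t)} (hc : Represents d F hdF t c a) (b : C) :
    Represents d F hdF t (c - d b) a := by
  obtain ⟨z, hz, rfl⟩ := hc
  have hb : dQ d F hdF t (Submodule.Quotient.mk (d b)) = 0 := by
    show Submodule.Quotient.mk ((d ∘ₗ d) b) = _
    rw [hdd]
    rfl
  refine ⟨z - ⟨Submodule.Quotient.mk (d b), hb⟩, ?_, ?_⟩
  · simp [hz]
  · refine (Submodule.Quotient.eq _).mpr ⟨Submodule.Quotient.mk (-b), ?_⟩
    show Submodule.Quotient.mk (d (-b)) =
      (z : C ⧸ F t) - Submodule.Quotient.mk (d b) - (z : C ⧸ F t)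
    simp

/-- A class in the inverse limit has representatives along `0, -1, -2, …` which form a
Cauchy sequence. -/
lemma exists_cauchy_represents (hdd : d ∘ₗ d = 0) {x : ∀ t, homologyOf (dQ d F hdF t)}
    (hx : x ∈ Hlim d F hmono hdF) :
    ∃ c : ℕ → C, (∀ n : ℕ, Represents d F hdF (-(n : ℝ)) (c n) (x (-(n : ℝ)))) ∧
      ∀ n m : ℕ, n ≤ m → c m - c n ∈ F (-(n : ℝ)) := by
  have step (n : ℕ) (c : {c // Represents d F hdF (-(n : ℝ)) c (x (-(n : ℝ)))}) :
      ∃ c' : {c // Represents d F hdF (-((n + 1 : ℕ) : ℝ)) c (x (-((n + 1 : ℕ) : ℝ)))},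
        c'.1 - c.1 ∈ F (-(n : ℝ)) := by
    have hle : -((n + 1 : ℕ) : ℝ) ≤ -(n : ℝ) := by push_cast; linarith
    obtain ⟨c', hc'⟩ := exists_represents d F hdF _ (x (-((n + 1 : ℕ) : ℝ)))
    have hn := hc'.mono hmono hle
    rw [hx hle] at hn
    obtain ⟨b, hb⟩ := c.2.exists_sub_sub_mem hn
    exact ⟨⟨c' - d b, hc'.sub_boundary hdd b⟩, hb⟩
  choose next hnext using step
  obtain ⟨c₀, hc₀⟩ := exists_represents d F hdF _ (x (-((0 : ℕ) : ℝ)))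
  let c (n : ℕ) : {c // Represents d F hdF (-(n : ℝ)) c (x (-(n : ℝ)))} :=
    Nat.rec ⟨c₀, hc₀⟩ next n
  refine ⟨fun n => (c n).1, fun n => (c n).2, fun n m hnm => ?_⟩
  induction m, hnm using Nat.le_induction with
  | base => simp
  | succ m hnm ih =>
    have hm : (c (m + 1)).1 - (c m).1 ∈ F (-(n : ℝ)) :=
      hmono (neg_le_neg (Nat.cast_le.mpr hnm)) (hnext m (c m))
    simpa using add_mem hm ih

lemma Phi_surjective (hdd : d ∘ₗ d = 0) : Function.Surjective (Phi d F hmono hdF) := by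
  rintro ⟨x, hx⟩
  obtain ⟨c, hrep, hcauchy⟩ := exists_cauchy_represents d F hmono hdF hdd hx
  have hN (t : ℝ) : -((⌈-t⌉₊ : ℕ) : ℝ) ≤ t := neg_le.mp (Nat.le_ceil (-t))
  have hrep' (t : ℝ) : Represents d F hdF t (c ⌈-t⌉₊) (x t) := by
    rw [← hx (hN t)]
    exact (hrep _).mono hmono (hN t)
  choose z hz hzx using hrep'
  refine ⟨⟨fun t => z t, fun s t h => ?_, ?_⟩, ?_⟩
  · simp only [hz]
    refine (Submodule.Quotient.eq _).mpr (hmono (hN t) (hcauchy _ _ ?_))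
    exact Nat.ceil_mono (neg_le_neg h)
  · exact funext fun t => (z t).2
  · exact Subtype.ext (funext hzx)

lemma ker_Phi : LinearMap.ker (Phi d F hmono hdF) = Nred d F hmono hdF := by
  ext x
  have hker : x ∈ LinearMap.ker (Phi d F hmono hdF) ↔
      ∀ t, x.1 t ∈ LinearMap.range (dQ d F hdF t) := by
    rw [LinearMap.mem_ker, Subtype.ext_iff, funext_iff]
    exact forall_congr' fun t => Submodule.Quotient.mk_eq_zero _
  rw [hker, Nred, Submodule.mem_comap, Submodule.mem_iInf]
  refine forall_congr' fun t => ⟨fun ⟨y, hy⟩ => ?_, fun h => ?_⟩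
  · obtain ⟨b, rfl⟩ := Submodule.Quotient.mk_surjective _ y
    let b' : ∀ t, C ⧸ F t := fun t => Submodule.Quotient.mk b
    have hb : b' ∈ Chat F hmono := fun _ _ _ => rfl
    have hdb : Dpi d F hdF b' ∈ Chat F hmono := fun _ _ _ => rfl
    refine Submodule.mem_sup.mpr ⟨_, Submodule.mem_map_of_mem hb, x.1 - Dpi d F hdF b',
      ⟨sub_mem x.2.1 hdb, ?_⟩, add_sub_cancel _ _⟩
    exact sub_eq_zero.mpr hy.symm
  · obtain ⟨_, ⟨y, -, rfl⟩, w, ⟨-, hw⟩, h⟩ := Submodule.mem_sup.mp h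
    have hw' : w t = 0 := hw
    refine ⟨y t, ?_⟩
    have ht : dQ d F hdF t (y t) + w t = x.1 t := congrFun h t
    rwa [hw', add_zero] at ht

/-- For a filtered complex `(C, d, F)` over a field `K`, the natural map
`Φ : ker d̂ → lim←_t H_t(C)` vanishes on `N := ⋂ t, (range d̂ + ker π_t)`, and the
induced map from the reduced cohomology `H̄(C) = ker d̂ ⧸ N` to the inverse limit
`lim←_t H_t(C)` is an isomorphism; the latter is expressed by `ker Φ = N` (injectivity of
the induced map, together with its well-definedness) and surjectivity of `Φ`. -/
theorem reduced_cohomology_iso_inverse_limit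
    (hdd : d ∘ₗ d = 0) :
    (∀ x ∈ Nred d F hmono hdF, Phi d F hmono hdF x = 0) ∧
    LinearMap.ker (Phi d F hmono hdF) = Nred d F hmono hdF ∧
    Function.Surjective (Phi d F hmono hdF) := by
  have hker := ker_Phi d F hmono hdF
  exact ⟨fun x hx => LinearMap.mem_ker.mp (hker ▸ hx), hker, Phi_surjective d F hmono hdF hdd⟩

end FilteredComplex
end

section
/- Let K be a field and let (C, d, F) and (C', d', F') be filtered complexes. Let φ : C → C' be a K-linear map with φ ∘ d = d' ∘ φ and φ(F t) ≤ F' t for all t ∈ ℝ, so that for every t, φ induces a chain map C ⧸ F t → C' ⧸ F' t and hence a map H_t(C) → H_t(C'). If for every t ∈ ℝ the induced map H_t(C) → H_t(C') is an isomorphism, then the induced map on reduced cohomologies H̄(C) → H̄(C') is an isomorphism. (In particular, a filtered quasi-isomorphism is a reduced quasi-isomorphism.) -/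
/-!
Statement 2: a filtered quasi-isomorphism of filtered complexes over a field is a reduced
quasi-isomorphism.

The completion `Ĉ` of a filtered complex `(C, d, F)` is realized as the submodule `Chat`
of compatible families of the product `∏ t, C ⧸ F t`; the differential `d̂` acts as (the
restriction of) the componentwise differential `Dpi`, and `π_t` is (the restriction of)
the projection.  Accordingly `ker d̂ = Chat ⊓ ker Dpi`, `range d̂ = Submodule.map Dpi Chat`
and `ker π_t = Chat ⊓ ker (LinearMap.proj t)` as submodules of the product, and the
reduced cohomology is `H̄(C) = ker d̂ ⧸ ⋂ t, (range d̂ + ker π_t)`.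
-/

section FilteredComplex

variable {K : Type*} [Field K]

variable {C : Type*} [AddCommGroup C] [Module K C]

variable {C' : Type*} [AddCommGroup C'] [Module K C']
variable (d : C →ₗ[K] C) (F : ℝ → Submodule K C)
variable (hmono : Monotone F) (hdF : ∀ t, (F t).map d ≤ F t)
variable (d' : C' →ₗ[K] C') (F' : ℝ → Submodule K C')
variable (hmono' : Monotone F') (hdF' : ∀ t, (F' t).map d' ≤ F' t)
variable (φ : C →ₗ[K] C')

section Maps

variable (hφF : ∀ t, (F t).map φ ≤ F' t)

/-- The map induced by a filtration-compatible map on the filtration quotients. -/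
def phiQ (t : ℝ) : (C ⧸ F t) →ₗ[K] (C' ⧸ F' t) :=
  Submodule.mapQ (F t) (F' t) φ (Submodule.map_le_iff_le_comap.mp (hφF t))

/-- The induced maps on the filtration quotients are chain maps. -/
lemma phiQ_dQ (hφd : φ ∘ₗ d = d' ∘ₗ φ) (t : ℝ) :
    (phiQ F F' φ hφF t) ∘ₗ (dQ d F hdF t) = (dQ d' F' hdF' t) ∘ₗ (phiQ F F' φ hφF t) := by
  apply Submodule.linearMap_qext
  refine LinearMap.ext fun x => ?_
  have hx := LinearMap.congr_fun hφd x
  simp only [LinearMap.comp_apply] at hx ⊢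
  simp only [Submodule.mkQ_apply, phiQ, dQ, Submodule.mapQ_apply]
  rw [hx]

/-- The componentwise map `∏ t, C ⧸ F t → ∏ t, C' ⧸ F' t` induced by `φ`; the induced
map `φ̂ : Ĉ → Ĉ'` of the completions is its restriction. -/
def phiPi : (∀ t : ℝ, C ⧸ F t) →ₗ[K] (∀ t : ℝ, C' ⧸ F' t) :=
  LinearMap.pi (fun t => (phiQ F F' φ hφF t).comp (LinearMap.proj t))

/-- The induced maps on the filtration quotients commute with the projections. -/
lemma phiQ_projQ {s t : ℝ} (h : s ≤ t) :
    (projQ F' hmono' h) ∘ₗ (phiQ F F' φ hφF s) =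
      (phiQ F F' φ hφF t) ∘ₗ (projQ F hmono h) := by
  apply Submodule.linearMap_qext
  rfl

/-- `φ̂` maps `d̂`-cycles to `d̂'`-cycles. -/
lemma phiPi_mem_Zhat (hφd : φ ∘ₗ d = d' ∘ₗ φ) :
    ∀ x ∈ Zhat d F hmono hdF, phiPi F F' φ hφF x ∈ Zhat d' F' hmono' hdF' := by
  intro x hx
  obtain ⟨hxC, hxD⟩ := Submodule.mem_inf.mp hx
  refine Submodule.mem_inf.mpr ⟨?_, ?_⟩
  · intro s t h
    have hc := LinearMap.congr_fun
      (phiQ_projQ F hmono F' hmono' φ hφF h) (x s)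
    simp only [LinearMap.comp_apply] at hc
    show projQ F' hmono' h (phiQ F F' φ hφF s (x s)) = phiQ F F' φ hφF t (x t)
    rw [hc, hxC h]
  · simp only [LinearMap.mem_ker] at hxD ⊢
    funext t
    have hct := LinearMap.congr_fun (phiQ_dQ d F hdF d' F' hdF' φ hφF hφd t) (x t)
    simp only [LinearMap.comp_apply] at hct
    have hx0 : dQ d F hdF t (x t) = 0 := congrFun hxD t
    show dQ d' F' hdF' t (phiQ F F' φ hφF t (x t)) = 0
    rw [← hct, hx0, map_zero]

/-- The map induced by `φ` on the `d̂`-cycles of the completions. -/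
def phiZ (hφd : φ ∘ₗ d = d' ∘ₗ φ) :
    (Zhat d F hmono hdF : Submodule K (∀ t : ℝ, C ⧸ F t)) →ₗ[K]
      (Zhat d' F' hmono' hdF' : Submodule K (∀ t : ℝ, C' ⧸ F' t)) :=
  (phiPi F F' φ hφF).restrict
    (phiPi_mem_Zhat d F hmono hdF d' F' hmono' hdF' φ hφF hφd)

end Maps

/-- A `d̂`-cycle lies in the closure of `range d̂` iff each of its components is a boundary. -/
lemma mem_Nred_iff (x : (Zhat d F hmono hdF : Submodule K (∀ t : ℝ, C ⧸ F t))) :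
    x ∈ Nred d F hmono hdF ↔
      ∀ t, ∃ w : C, (x : ∀ t : ℝ, C ⧸ F t) t = (F t).mkQ (d w) := by
  rw [Nred, Submodule.mem_comap, Submodule.mem_iInf]
  refine forall_congr' fun t => ?_
  rw [Submodule.mem_sup]
  constructor
  · rintro ⟨_, ⟨c, -, rfl⟩, k, ⟨-, hk⟩, hck⟩
    obtain ⟨w, hw⟩ := (F t).mkQ_surjective (c t)
    have hk : k t = 0 := hk
    refine ⟨w, ?_⟩
    have hckt : dQ d F hdF t (c t) + k t = (x : ∀ t : ℝ, C ⧸ F t) t := congrFun hck t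
    rw [← hckt, hk, add_zero, ← hw]
    rfl
  · rintro ⟨w, hw⟩
    have hconst (v : C) : (fun t => (F t).mkQ v) ∈ Chat F hmono := fun _ _ _ => rfl
    refine ⟨fun t => (F t).mkQ (d w), ⟨fun t => (F t).mkQ w, hconst w, rfl⟩,
      (x : ∀ t : ℝ, C ⧸ F t) - fun t => (F t).mkQ (d w),
      ⟨Submodule.sub_mem _ x.2.1 (hconst _), ?_⟩, add_sub_cancel _ _⟩
    exact sub_eq_zero.mpr hw

/-- Membership in the kernel of the induced map on homology, in terms of representatives. -/
lemma exists_sub_mem_of_injective_inducedHom (hφd : φ ∘ₗ d = d' ∘ₗ φ)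
    (hφF : ∀ t, (F t).map φ ≤ F' t) {t : ℝ}
    (hinj : Function.Injective
      (inducedHom (dQ d F hdF t) (dQ d' F' hdF' t) (phiQ F F' φ hφF t)
        (phiQ_dQ d F hdF d' F' hdF' φ hφF hφd t)))
    {z : C} (hz : d z ∈ F t) {w : C'} (hw : φ z - d' w ∈ F' t) :
    ∃ v, z - d v ∈ F t := by
  have hz' : (F t).mkQ z ∈ LinearMap.ker (dQ d F hdF t) :=
    (Submodule.Quotient.mk_eq_zero (F t)).mpr hz
  have h0 : Submodule.Quotient.mk (⟨(F t).mkQ z, hz'⟩ : LinearMap.ker (dQ d F hdF t)) =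
      (0 : homologyOf (dQ d F hdF t)) := by
    apply hinj
    rw [map_zero]
    refine (Submodule.Quotient.mk_eq_zero _).mpr ?_
    exact ⟨(F' t).mkQ w, ((Submodule.Quotient.eq (F' t)).mpr hw).symm⟩
  obtain ⟨q, hq⟩ := (Submodule.Quotient.mk_eq_zero _).mp h0
  obtain ⟨v, rfl⟩ := (F t).mkQ_surjective q
  exact ⟨v, (Submodule.Quotient.eq (F t)).mp hq.symm⟩

/-- Surjectivity of the induced map on homology, in terms of representatives. -/
lemma exists_sub_sub_mem_of_surjective_inducedHom (hφd : φ ∘ₗ d = d' ∘ₗ φ)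
    (hφF : ∀ t, (F t).map φ ≤ F' t) {t : ℝ}
    (hsurj : Function.Surjective
      (inducedHom (dQ d F hdF t) (dQ d' F' hdF' t) (phiQ F F' φ hφF t)
        (phiQ_dQ d F hdF d' F' hdF' φ hφF hφd t)))
    {y : C'} (hy : d' y ∈ F' t) :
    ∃ z w, d z ∈ F t ∧ φ z - y - d' w ∈ F' t := by
  have hy' : (F' t).mkQ y ∈ LinearMap.ker (dQ d' F' hdF' t) :=
    (Submodule.Quotient.mk_eq_zero (F' t)).mpr hy
  obtain ⟨a, ha⟩ := hsurj (Submodule.Quotient.mk ⟨(F' t).mkQ y, hy'⟩)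
  obtain ⟨⟨q, hq⟩, rfl⟩ := Submodule.Quotient.mk_surjective _ a
  obtain ⟨z, rfl⟩ := (F t).mkQ_surjective q
  obtain ⟨r, hr⟩ := (Submodule.Quotient.eq _).mp ha
  obtain ⟨w, rfl⟩ := (F' t).mkQ_surjective r
  refine ⟨z, w, (Submodule.Quotient.mk_eq_zero (F t)).mp hq, ?_⟩
  exact (Submodule.Quotient.eq (F' t)).mp hr.symm

/-- A sequence that is Cauchy for the filtration, and whose differentials tend to zero,
converges to a `d̂`-cycle. -/
lemma mkQ_ceil_mem_Zhat (x : ℕ → C) (hx : ∀ n : ℕ, x (n + 1) - x n ∈ F (-n))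
    (hdx : ∀ n : ℕ, d (x n) ∈ F (-n)) :
    (fun t => (F t).mkQ (x ⌈-t⌉₊)) ∈ Zhat d F hmono hdF := by
  have hcauchy : ∀ {n m : ℕ}, n ≤ m → x m - x n ∈ F (-n) := by
    intro n m hnm
    induction m, hnm using Nat.le_induction with
    | base => simp
    | succ m hnm ih =>
      have hle : F (-m) ≤ F (-n) := hmono (neg_le_neg (Nat.cast_le.mpr hnm))
      simpa using add_mem (hle (hx m)) ih
  have hceil (t : ℝ) : F (-(⌈-t⌉₊ : ℝ)) ≤ F t := hmono (neg_le.mp (Nat.le_ceil (-t)))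
  refine ⟨fun s t h => ?_, ?_⟩
  · exact (Submodule.Quotient.eq (F t)).mpr
      (hceil t (hcauchy (Nat.ceil_mono (neg_le_neg h))))
  · rw [SetLike.mem_coe, LinearMap.mem_ker]
    funext t
    exact (Submodule.Quotient.mk_eq_zero (F t)).mpr (hceil t (hdx _))

/-- Let `φ` be a filtration-compatible chain map between filtered
complexes over a field `K`.  If for every `t ∈ ℝ` the induced map `H_t(C) → H_t(C')` on
truncated cohomology is an isomorphism (i.e. `φ` is a filtered quasi-isomorphism), then
the induced map on reduced cohomologies `H̄(C) → H̄(C')` is an isomorphism (i.e. `φ` is a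
reduced quasi-isomorphism): the induced map `φ̂` on `d̂`-cycles carries
`N = ⋂ t, (range d̂ + ker π_t)` into `N'`, the preimage of `N'` is exactly `N`
(well-definedness and injectivity of the induced map on the quotients), and every
`d̂'`-cycle agrees with the image of a `d̂`-cycle modulo `N'` (surjectivity). -/
theorem filtered_quasi_iso_is_reduced_quasi_iso
    (hdd : d ∘ₗ d = 0) (hdd' : d' ∘ₗ d' = 0)
    (hφd : φ ∘ₗ d = d' ∘ₗ φ) (hφF : ∀ t, (F t).map φ ≤ F' t)
    (hiso : ∀ t : ℝ, Function.Bijective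
      (inducedHom (dQ d F hdF t) (dQ d' F' hdF' t) (phiQ F F' φ hφF t)
        (phiQ_dQ d F hdF d' F' hdF' φ hφF hφd t))) :
    (∀ x ∈ Nred d F hmono hdF,
        phiZ d F hmono hdF d' F' hmono' hdF' φ hφF hφd x ∈ Nred d' F' hmono' hdF') ∧
    (∀ x, phiZ d F hmono hdF d' F' hmono' hdF' φ hφF hφd x ∈ Nred d' F' hmono' hdF' →
        x ∈ Nred d F hmono hdF) ∧
    (∀ y : (Zhat d' F' hmono' hdF' : Submodule K (∀ t : ℝ, C' ⧸ F' t)),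
        ∃ x, phiZ d F hmono hdF d' F' hmono' hdF' φ hφF hφd x - y ∈
          Nred d' F' hmono' hdF') := by
  have hφd' (c : C) : φ (d c) = d' (φ c) := LinearMap.congr_fun hφd c
  refine ⟨fun x hx => ?_, fun x hx => ?_, fun y => ?_⟩
  · rw [mem_Nred_iff] at hx ⊢
    intro t
    obtain ⟨w, hw⟩ := hx t
    refine ⟨φ w, ?_⟩
    rw [← hφd']
    exact congrArg (phiQ F F' φ hφF t) hw
  · rw [mem_Nred_iff] at hx ⊢
    intro t
    obtain ⟨w, hw⟩ := hx t
    obtain ⟨z, hz⟩ := (F t).mkQ_surjective ((x : ∀ t : ℝ, C ⧸ F t) t)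
    have hdz : d z ∈ F t := by
      have h0 : dQ d F hdF t ((x : ∀ t : ℝ, C ⧸ F t) t) = 0 := congrFun x.2.2 t
      rw [← hz] at h0
      exact (Submodule.Quotient.mk_eq_zero (F t)).mp h0
    have hzw : phiQ F F' φ hφF t ((x : ∀ t : ℝ, C ⧸ F t) t) = (F' t).mkQ (d' w) := hw
    rw [← hz] at hzw
    obtain ⟨v, hv⟩ := exists_sub_mem_of_injective_inducedHom d F hdF d' F' hdF' φ hφd hφF
      (hiso t).1 hdz ((Submodule.Quotient.eq (F' t)).mp hzw)
    exact ⟨v, hz.symm.trans ((Submodule.Quotient.eq (F t)).mpr hv)⟩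
  · choose Y hY using fun t => (F' t).mkQ_surjective ((y : ∀ t : ℝ, C' ⧸ F' t) t)
    have hdY (t : ℝ) : d' (Y t) ∈ F' t := by
      have h0 : dQ d' F' hdF' t ((y : ∀ t : ℝ, C' ⧸ F' t) t) = 0 := congrFun y.2.2 t
      rw [← hY] at h0
      exact (Submodule.Quotient.mk_eq_zero (F' t)).mp h0
    have hYY {s t : ℝ} (h : s ≤ t) : Y s - Y t ∈ F' t := by
      have h0 := y.2.1 h
      rw [← hY, ← hY] at h0
      exact (Submodule.Quotient.eq (F' t)).mp h0
    choose z w hdz hzw using fun n : ℕ => exists_sub_sub_mem_of_surjective_inducedHom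
      d F hdF d' F' hdF' φ hφd hφF (hiso (-n)).2 (hdY (-n))
    have hstep (n : ℕ) : (-((n + 1 : ℕ) : ℝ)) ≤ -n := by
      push_cast
      linarith
    have hdiff (n : ℕ) : ∃ v, z (n + 1) - z n - d v ∈ F (-n) := by
      refine exists_sub_mem_of_injective_inducedHom d F hdF d' F' hdF' φ hφd hφF
        (hiso (-n)).1 (w := w (n + 1) - w n) ?_ ?_
      · rw [map_sub]
        exact sub_mem (hmono (hstep n) (hdz (n + 1))) (hdz n)
      · convert add_mem (sub_mem (hmono' (hstep n) (hzw (n + 1))) (hzw n)) (hYY (hstep n))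
          using 1
        simp only [map_sub]
        abel
    choose v hv using hdiff
    let x : ℕ → C := fun n => z n - d (∑ i ∈ Finset.range n, v i)
    have hx : ∀ n : ℕ, x (n + 1) - x n ∈ F (-n) := by
      intro n
      convert hv n using 1
      simp only [x, Finset.sum_range_succ, map_add]
      abel
    have hdx : ∀ n : ℕ, d (x n) ∈ F (-n) := by
      intro n
      have hdd0 (c : C) : d (d c) = 0 := LinearMap.congr_fun hdd c
      simpa only [x, map_sub, hdd0, sub_zero] using hdz n
    refine ⟨⟨_, mkQ_ceil_mem_Zhat d F hmono hdF x hx hdx⟩, ?_⟩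
    rw [mem_Nred_iff]
    intro t
    have hceil : -(⌈-t⌉₊ : ℝ) ≤ t := neg_le.mp (Nat.le_ceil (-t))
    refine ⟨w ⌈-t⌉₊ - φ (∑ i ∈ Finset.range ⌈-t⌉₊, v i), ?_⟩
    change (F' t).mkQ (φ (x ⌈-t⌉₊)) - (y : ∀ t : ℝ, C' ⧸ F' t) t = _
    rw [← hY, ← map_sub]
    refine (Submodule.Quotient.eq (F' t)).mpr ?_
    convert add_mem (hmono' hceil (hzw ⌈-t⌉₊)) (hYY hceil) using 1
    simp only [x, map_sub, hφd']
    abel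

end FilteredComplex
end
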